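/- Let X be a completely regular (Hausdorff) topological space and let H be a non-vanishing self-adjoint closed subalgebra of C_B(X) which separates points from closed sets in X. If H is countably generated (i.e., H is the smallest closed subalgebra of C_B(X) containing some countable subset {h₁, h₂, ...} of H), then the locally compact space λ_H X = ⋃_{h∈H} Coz(h_α) ⊆ α_H X is separable and metrizable. -/

import Mathlib

open Set Topology

/-- `H ⊆ C_B(X)` separates points from closed sets in `X`. -/
def SeparatesPointsFromClosedSets {X : Type*} [TopologicalSpace X]
    (H : Set (BoundedContinuousFunction X ℂ)) : Prop :=
  ∀ C : Set X, IsClosed C → ∀ x ∉ C, ∃ h ∈ H, h x ∉ closure ((h : X → ℂ) '' C)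

/-- The evaluation map `e : X → ∏_{h ∈ H} cl_ℂ(h(X))`. -/
noncomputable def evalMap {X : Type*} [TopologicalSpace X]
    (H : Set (BoundedContinuousFunction X ℂ)) (x : X) :
    (h : H) → (closure (Set.range ((h : BoundedContinuousFunction X ℂ) : X → ℂ)) : Set ℂ) :=
  fun h => ⟨(h : BoundedContinuousFunction X ℂ) x, subset_closure ⟨x, rfl⟩⟩

/-- The compactification `α_H X`, as the closure of `e(X)` in the product. -/
noncomputable def alphaSet {X : Type*} [TopologicalSpace X]
    (H : Set (BoundedContinuousFunction X ℂ)) :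
    Set ((h : H) → (closure (Set.range ((h : BoundedContinuousFunction X ℂ) : X → ℂ)) : Set ℂ)) :=
  closure (Set.range (evalMap H))

/-- The corestriction `X → α_H X` of the evaluation map. -/
noncomputable def evalAlpha {X : Type*} [TopologicalSpace X]
    (H : Set (BoundedContinuousFunction X ℂ)) (x : X) : alphaSet H :=
  ⟨evalMap H x, subset_closure ⟨x, rfl⟩⟩

/-- The extension `h_α : α_H X → ℂ` of `h ∈ H`, i.e. the restriction to `α_H X` of the
projection onto the `h`-th coordinate. -/
noncomputable def hAlpha {X : Type*} [TopologicalSpace X]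
    (H : Set (BoundedContinuousFunction X ℂ)) (h : H) (z : alphaSet H) : ℂ :=
  (z.1 h : ℂ)

/-- The subspace `λ_H X = ⋃_{h ∈ H} Coz(h_α)` of `α_H X`. -/
noncomputable def lambdaSet {X : Type*} [TopologicalSpace X]
    (H : Set (BoundedContinuousFunction X ℂ)) : Set (alphaSet H) :=
  {z : alphaSet H | ∃ h : H, hAlpha H h z ≠ 0}

section Evaluation

variable {X : Type*} [TopologicalSpace X]

theorem continuous_hAlpha (H : Set (BoundedContinuousFunction X ℂ)) (h : H) :
    Continuous (hAlpha H h) :=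
  continuous_subtype_val.comp ((continuous_apply h).comp continuous_subtype_val)

/-- A closed condition on `α_H X` that holds on the image of `X` holds everywhere. -/
theorem alphaSet_induction {H : Set (BoundedContinuousFunction X ℂ)} {p : alphaSet H → Prop}
    (hp : IsClosed {z | p z}) (he : ∀ x, p (evalAlpha H x)) (z : alphaSet H) : p z := by
  have hz : z ∈ closure (Set.range (evalAlpha H)) := by
    rw [closure_subtype, ← Set.range_comp]
    exact z.2
  exact closure_minimal (Set.range_subset_iff.2 he) hp hz

instance compactSpace_alphaSet (H : Set (BoundedContinuousFunction X ℂ)) :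
    CompactSpace (alphaSet H) := by
  have (h : H) : CompactSpace
      (closure (Set.range ((h : BoundedContinuousFunction X ℂ) : X → ℂ)) : Set ℂ) :=
    isCompact_iff_compactSpace.1 h.1.isBounded_range.isCompact_closure
  exact isCompact_iff_compactSpace.1 isClosed_closure.isCompact

theorem norm_hAlpha_sub_le {H : Set (BoundedContinuousFunction X ℂ)} (f g : H)
    (z : alphaSet H) : ‖hAlpha H f z - hAlpha H g z‖ ≤ dist f.1 g.1 :=
  alphaSet_induction (p := fun z => ‖hAlpha H f z - hAlpha H g z‖ ≤ dist f.1 g.1)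
    (isClosed_le ((continuous_hAlpha H f).sub (continuous_hAlpha H g)).norm continuous_const)
    (fun x => by
      rw [← dist_eq_norm]
      exact BoundedContinuousFunction.dist_coe_le_dist x) z

variable (H : NonUnitalStarSubalgebra ℂ (BoundedContinuousFunction X ℂ))

theorem hAlpha_add (f g : H) (z : alphaSet (H : Set (BoundedContinuousFunction X ℂ))) :
    hAlpha _ (f + g) z = hAlpha _ f z + hAlpha _ g z :=
  alphaSet_induction (p := fun z => hAlpha _ (f + g) z = hAlpha _ f z + hAlpha _ g z)
    (isClosed_eq (continuous_hAlpha _ _) ((continuous_hAlpha _ f).add (continuous_hAlpha _ g)))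
    (fun _ => rfl) z

theorem hAlpha_mul (f g : H) (z : alphaSet (H : Set (BoundedContinuousFunction X ℂ))) :
    hAlpha _ (f * g) z = hAlpha _ f z * hAlpha _ g z :=
  alphaSet_induction (p := fun z => hAlpha _ (f * g) z = hAlpha _ f z * hAlpha _ g z)
    (isClosed_eq (continuous_hAlpha _ _) ((continuous_hAlpha _ f).mul (continuous_hAlpha _ g)))
    (fun _ => rfl) z

theorem hAlpha_smul (c : ℂ) (f : H)
    (z : alphaSet (H : Set (BoundedContinuousFunction X ℂ))) :
    hAlpha _ (c • f) z = c * hAlpha _ f z :=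
  alphaSet_induction (p := fun z => hAlpha _ (c • f) z = c * hAlpha _ f z)
    (isClosed_eq (continuous_hAlpha _ _) (continuous_const.mul (continuous_hAlpha _ f)))
    (fun _ => rfl) z

theorem hAlpha_zero (z : alphaSet (H : Set (BoundedContinuousFunction X ℂ))) :
    hAlpha _ (0 : H) z = 0 :=
  alphaSet_induction (p := fun z => hAlpha _ (0 : H) z = 0)
    (isClosed_eq (continuous_hAlpha _ _) continuous_const) (fun _ => rfl) z

/-- The subalgebra of those `f ∈ H` whose extensions to `α_H X` agree at `z` and `w`. -/
def agreementSubalgebra (z w : alphaSet (H : Set (BoundedContinuousFunction X ℂ))) :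
    NonUnitalSubalgebra ℂ (BoundedContinuousFunction X ℂ) where
  carrier := {f | ∃ hf : f ∈ H, hAlpha (H : Set _) ⟨f, hf⟩ z = hAlpha (H : Set _) ⟨f, hf⟩ w}
  add_mem' := by
    rintro f g ⟨hf, hfe⟩ ⟨hg, hge⟩
    have h := hAlpha_add H ⟨f, hf⟩ ⟨g, hg⟩
    exact ⟨add_mem hf hg, (h z).trans ((congrArg₂ _ hfe hge).trans (h w).symm)⟩
  zero_mem' := ⟨zero_mem H, (hAlpha_zero H z).trans (hAlpha_zero H w).symm⟩
  mul_mem' := by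
    rintro f g ⟨hf, hfe⟩ ⟨hg, hge⟩
    have h := hAlpha_mul H ⟨f, hf⟩ ⟨g, hg⟩
    exact ⟨mul_mem hf hg, (h z).trans ((congrArg₂ _ hfe hge).trans (h w).symm)⟩
  smul_mem' := by
    rintro c f ⟨hf, hfe⟩
    have h := hAlpha_smul H c ⟨f, hf⟩
    exact ⟨SMulMemClass.smul_mem c hf, (h z).trans ((congrArg _ hfe).trans (h w).symm)⟩

variable {H}

theorem isClosed_agreementSubalgebra
    (hclosed : IsClosed (H : Set (BoundedContinuousFunction X ℂ)))
    (z w : alphaSet (H : Set (BoundedContinuousFunction X ℂ))) :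
    IsClosed (agreementSubalgebra H z w : Set (BoundedContinuousFunction X ℂ)) := by
  have hcont (y : alphaSet (H : Set (BoundedContinuousFunction X ℂ))) :
      Continuous fun f : (H : Set (BoundedContinuousFunction X ℂ)) => hAlpha _ f y :=
    (LipschitzWith.of_dist_le_mul (K := 1) fun f g => by
      simpa [dist_eq_norm] using norm_hAlpha_sub_le f g y).continuous
  convert hclosed.isClosedEmbedding_subtypeVal.isClosedMap _
    (isClosed_eq (hcont z) (hcont w)) using 1
  ext f
  exact ⟨fun ⟨hf, h⟩ => ⟨⟨f, hf⟩, h, rfl⟩, by rintro ⟨g, h, rfl⟩; exact ⟨g.2, h⟩⟩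

end Evaluation

/-- if `H` is countably generated (i.e. `H` is the smallest closed
subalgebra of `C_B(X)` containing some countable subset of `H`), then the locally
compact space `λ_H X` is separable and metrizable. -/
theorem lambdaSet_separable_metrizable_of_countably_generated {X : Type*}
    [TopologicalSpace X] [CompletelyRegularSpace X] [T2Space X]
    (H : NonUnitalStarSubalgebra ℂ (BoundedContinuousFunction X ℂ))
    (hclosed : IsClosed (H : Set (BoundedContinuousFunction X ℂ)))
    (hnv : ∀ x : X, ∃ h ∈ H, h x ≠ 0)
    (hsep : SeparatesPointsFromClosedSets (H : Set (BoundedContinuousFunction X ℂ)))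
    (hgen : ∃ S : Set (BoundedContinuousFunction X ℂ), S.Countable ∧
      S ⊆ (H : Set (BoundedContinuousFunction X ℂ)) ∧
      ∀ K : NonUnitalSubalgebra ℂ (BoundedContinuousFunction X ℂ),
        IsClosed (K : Set (BoundedContinuousFunction X ℂ)) →
        S ⊆ (K : Set (BoundedContinuousFunction X ℂ)) →
        (H : Set (BoundedContinuousFunction X ℂ)) ⊆
          (K : Set (BoundedContinuousFunction X ℂ))) :
    TopologicalSpace.SeparableSpace
      (lambdaSet (H : Set (BoundedContinuousFunction X ℂ))) ∧
    TopologicalSpace.MetrizableSpace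
      (lambdaSet (H : Set (BoundedContinuousFunction X ℂ))) := by
  obtain ⟨S, hS, hSH, hmin⟩ := hgen
  have : Countable S := hS.to_subtype
  let F : alphaSet (H : Set (BoundedContinuousFunction X ℂ)) → S → ℂ :=
    fun z s => hAlpha _ ⟨s, hSH s.2⟩ z
  have hF : Continuous F := continuous_pi fun s => continuous_hAlpha _ _
  have hinj : Function.Injective F := by
    intro z w hzw
    ext h
    obtain ⟨_, hzh⟩ := hmin (agreementSubalgebra H z w)
      (isClosed_agreementSubalgebra hclosed z w)
      (fun s hs => ⟨hSH hs, congrFun hzw ⟨s, hs⟩⟩) h.2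
    exact hzh
  have hemb := hF.isClosedEmbedding hinj
  have hsc : SecondCountableTopology (alphaSet (H : Set (BoundedContinuousFunction X ℂ))) :=
    hemb.isEmbedding.secondCountableTopology
  have hmet : TopologicalSpace.MetrizableSpace
      (alphaSet (H : Set (BoundedContinuousFunction X ℂ))) :=
    hemb.isEmbedding.metrizableSpace
  exact ⟨inferInstance, inferInstance⟩
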